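/- Let (F_n, T_n, q_n) be an odometer datum with inverse limit Z and induced odometer T : Z → Z. Then T is minimal (every T-orbit { T^k z : k ∈ ℤ } is dense in Z) if and only if for every n the bijection T_n acts transitively on F_n, i.e., T_n is a permutation consisting of a single cycle. -/

import Mathlib

/-- The odometer induced on the inverse limit
`Z = { z ∈ ∏ n, F n | ∀ n, q n (z (n+1)) = z n }`
by a compatible sequence of bijections `T n : F n ≃ F n`:
it sends `z` to the point whose `n`-th coordinate is `T n (z n)`. -/
def odoPerm (F : ℕ → Type*) (T : ∀ n, Equiv.Perm (F n)) (q : ∀ n, F (n + 1) → F n)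
    (hcomm : ∀ n x, q n (T (n + 1) x) = T n (q n x)) :
    Equiv.Perm { z : ∀ n, F n // ∀ n, q n (z (n + 1)) = z n } where
  toFun z := ⟨fun n => T n (z.1 n), fun n => by rw [hcomm, z.2]⟩
  invFun z := ⟨fun n => (T n).symm (z.1 n), fun n => by
    rw [Equiv.eq_symm_apply, ← hcomm, Equiv.apply_symm_apply, z.2]⟩
  left_inv z := Subtype.ext (funext fun n => (T n).symm_apply_apply _)
  right_inv z := Subtype.ext (funext fun n => (T n).apply_symm_apply _)

theorem odo_exists_thread (n : ℕ) : ∀ (F : ℕ → Type*) (q : ∀ n, F (n + 1) → F n)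
    (_ : ∀ n, Function.Surjective (q n)) (x : F n),
    ∃ z : ∀ n, F n, (∀ n, q n (z (n + 1)) = z n) ∧ z n = x := by
  induction n with
  | zero =>
    intro F q hq x
    exact ⟨fun n => Nat.rec x (fun k y => Function.surjInv (hq k) y) n,
      fun n => Function.surjInv_eq (hq n) _, rfl⟩
  | succ n ih =>
    intro F q hq x
    obtain ⟨z, hz, hx⟩ := ih (fun k => F (k + 1)) (fun k => q (k + 1)) (fun k => hq (k + 1)) x
    refine ⟨fun k => Nat.casesOn k (q 0 (z 0)) z, ?_, hx⟩
    intro k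
    cases k with
    | zero => rfl
    | succ k => exact hz k

theorem odo_zpow_apply (F : ℕ → Type*) (T : ∀ n, Equiv.Perm (F n)) (q : ∀ n, F (n + 1) → F n)
    (hcomm : ∀ n x, q n (T (n + 1) x) = T n (q n x)) (k : ℤ) (n : ℕ)
    (z : { z : ∀ n, F n // ∀ n, q n (z (n + 1)) = z n }) :
    (((odoPerm F T q hcomm) ^ k) z).1 n = ((T n) ^ k) (z.1 n) := by
  induction k generalizing z with
  | zero => simp
  | succ k ih => rw [zpow_add_one, zpow_add_one, Equiv.Perm.mul_apply, ih]; rfl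
  | pred k ih => rw [zpow_sub_one, zpow_sub_one, Equiv.Perm.mul_apply, ih]; rfl

theorem odo_eq_below (F : ℕ → Type*) (q : ∀ n, F (n + 1) → F n)
    (z w : ∀ n, F n) (hz : ∀ n, q n (z (n + 1)) = z n) (hw : ∀ n, q n (w (n + 1)) = w n)
    (N : ℕ) (h : z N = w N) (m : ℕ) (hm : m ≤ N) : z m = w m := by
  induction N with
  | zero => obtain rfl : m = 0 := by omega
            exact h
  | succ N ih =>
    rcases Nat.lt_or_ge N m with h1 | h1
    · obtain rfl : m = N + 1 := by omega
      exact h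
    · exact ih (by rw [← hz, ← hw, h]) h1

/-- **Minimality criterion for odometers.**
Let `(F n, T n, q n)` be an odometer datum (each `F n` a nonempty finite discrete
space, `T n` a bijection of `F n`, `q n : F (n+1) → F n` a surjection with
`T n ∘ q n = q n ∘ T (n+1)`), with inverse limit `Z` and induced odometer `T`.
Then `T` is minimal (every `T`-orbit is dense in `Z`) if and only if every `T n`
acts transitively on `F n`, i.e. `T n` is a single cycle. -/
theorem odometer_minimal_iff_levelwise_transitive
    (F : ℕ → Type*) [∀ n, TopologicalSpace (F n)] [∀ n, DiscreteTopology (F n)]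
    [∀ n, Fintype (F n)] [∀ n, Nonempty (F n)]
    (T : ∀ n, Equiv.Perm (F n)) (q : ∀ n, F (n + 1) → F n)
    (hq : ∀ n, Function.Surjective (q n))
    (hcomm : ∀ n x, q n (T (n + 1) x) = T n (q n x)) :
    (∀ z : { z : ∀ n, F n // ∀ n, q n (z (n + 1)) = z n },
        Dense (Set.range fun k : ℤ => ((odoPerm F T q hcomm) ^ k) z)) ↔
      (∀ n, ∀ x y : F n, ∃ k : ℤ, ((T n) ^ k) x = y) := by
  constructor
  · intro H n x y
    obtain ⟨z, hz, rfl⟩ := odo_exists_thread n F q hq x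
    obtain ⟨w, hw, rfl⟩ := odo_exists_thread n F q hq y
    have hc : Continuous fun v : { z : ∀ n, F n // ∀ n, q n (z (n + 1)) = z n } => v.1 n :=
      (continuous_apply n).comp continuous_subtype_val
    obtain ⟨v, hv, k, rfl⟩ := dense_iff_inter_open.1 (H ⟨z, hz⟩) _
      ((isOpen_discrete {w n}).preimage hc) ⟨⟨w, hw⟩, rfl⟩
    refine ⟨k, ?_⟩
    rw [← odo_zpow_apply F T q hcomm k n ⟨z, hz⟩]
    exact hv
  · intro H z
    rw [dense_iff_inter_open]
    rintro U hU ⟨w, hw⟩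
    obtain ⟨V, hV, rfl⟩ := isOpen_induced_iff.1 hU
    obtain ⟨I, u, hu, hsub⟩ := isOpen_pi_iff.1 hV w.1 hw
    obtain ⟨k, hk⟩ := H (I.sup id) (z.1 _) (w.1 _)
    refine ⟨((odoPerm F T q hcomm) ^ k) z, hsub ?_, k, rfl⟩
    intro m hm
    have hle : m ≤ I.sup id := Finset.le_sup (f := id) hm
    rw [odo_eq_below F q _ w.1 (((odoPerm F T q hcomm) ^ k) z).2 w.2 (I.sup id)
      ((odo_zpow_apply F T q hcomm k _ z).trans hk) m hle]
    exact (hu m hm).2
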